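/- Suppose Ψ satisfies Assumption 1. Let (μ_j) be positive reals with μ_j → 0, and let (w̃^j) ⊂ D be points satisfying ‖∇f_{μ_j}(w̃^j)‖ → 0 (where ∇f_{μ_j} is the gradient of f_{μ_j} on D). Set w^j = w(w̃^j). Then Ψ((K^T M(w^j)^{-1} K)^{-1}) → f*, and every accumulation point of the sequence (w^j) is an optimal solution of the design problem. -/

import Mathlib

open Matrix Filter Topology

noncomputable section

attribute [local instance] Matrix.normedAddCommGroup Matrix.normedSpace

/-- Assumption 1: `Ψ` is convex, decreasing, twice continuously differentiable and bounded
below on the set of `k × k` real symmetric positive definite matrices, and `Ψ (X j) → ∞`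
whenever `(X j)` is a bounded sequence of positive definite matrices whose smallest
eigenvalues tend to `0`.  (Over `ℝ`, `Matrix.PosDef` includes symmetry.) -/
structure Assumption1 (k : ℕ) (Ψ : Matrix (Fin k) (Fin k) ℝ → ℝ) : Prop where
  convex : ∀ A B : Matrix (Fin k) (Fin k) ℝ, A.PosDef → B.PosDef →
    ∀ t : ℝ, 0 ≤ t → t ≤ 1 → Ψ (t • A + (1 - t) • B) ≤ t * Ψ A + (1 - t) * Ψ B
  decreasing : ∀ A B : Matrix (Fin k) (Fin k) ℝ, A.IsHermitian → B.PosDef →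
    (A - B).PosSemidef → Ψ A ≤ Ψ B
  smooth : ContDiffOn ℝ 2 Ψ {U : Matrix (Fin k) (Fin k) ℝ | U.PosDef}
  bddBelow : ∃ c : ℝ, ∀ U : Matrix (Fin k) (Fin k) ℝ, U.PosDef → c ≤ Ψ U
  blowup : ∀ (X : ℕ → Matrix (Fin k) (Fin k) ℝ) (hp : ∀ j, (X j).PosDef),
    (∃ C : ℝ, ∀ j i l, |X j i l| ≤ C) →
    Tendsto (fun j => ⨅ i, (hp j).isHermitian.eigenvalues i) atTop (𝓝 0) →
    Tendsto (fun j => Ψ (X j)) atTop atTop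

/-- The simplex of designs. -/
def Omega (n : ℕ) : Set (Fin n → ℝ) := {w | (∀ i, 0 ≤ w i) ∧ ∑ i, w i = 1}

/-- The moment matrix `M(w) = ∑ i, w i • A i`. -/
def Mmat {n m : ℕ} (A : Fin n → Matrix (Fin m) (Fin m) ℝ) (w : Fin n → ℝ) :
    Matrix (Fin m) (Fin m) ℝ := ∑ i, w i • A i

/-- `Range K ⊆ Range X`. -/
def RangeIncl {m k : ℕ} (K : Matrix (Fin m) (Fin k) ℝ) (X : Matrix (Fin m) (Fin m) ℝ) : Prop :=
  LinearMap.range (Matrix.toLin' K) ≤ LinearMap.range (Matrix.toLin' X)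

/-- `Φ̂(X) = inf {Ψ U | U symmetric positive definite, X - K U Kᵀ positive semidefinite}`. -/
def PhiHat {m k : ℕ} (K : Matrix (Fin m) (Fin k) ℝ) (Ψ : Matrix (Fin k) (Fin k) ℝ → ℝ)
    (X : Matrix (Fin m) (Fin m) ℝ) : ℝ :=
  sInf {y | ∃ U : Matrix (Fin k) (Fin k) ℝ, U.PosDef ∧ (X - K * U * Kᵀ).PosSemidef ∧ y = Ψ U}

/-- The optimal value `f*` of the design problem. -/
def fstar {n m k : ℕ} (A : Fin n → Matrix (Fin m) (Fin m) ℝ) (K : Matrix (Fin m) (Fin k) ℝ)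
    (Ψ : Matrix (Fin k) (Fin k) ℝ → ℝ) : ℝ :=
  sInf {y | ∃ w ∈ Omega n, RangeIncl K (Mmat A w) ∧ y = PhiHat K Ψ (Mmat A w)}

/-- `w` is an optimal solution of the design problem. -/
def IsOptimal {n m k : ℕ} (A : Fin n → Matrix (Fin m) (Fin m) ℝ) (K : Matrix (Fin m) (Fin k) ℝ)
    (Ψ : Matrix (Fin k) (Fin k) ℝ → ℝ) (w : Fin n → ℝ) : Prop :=
  w ∈ Omega n ∧ RangeIncl K (Mmat A w) ∧ PhiHat K Ψ (Mmat A w) = fstar A K Ψ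

/-- The open domain `D` of the barrier subproblem. -/
def Dset (n : ℕ) : Set (Fin (n - 1) → ℝ) := {wt | (∀ i, 0 < wt i) ∧ ∑ i, wt i < 1}

/-- `w(w̃) = (w̃₁, …, w̃_{n-1}, 1 - ∑ w̃ᵢ)`. -/
def extendW (n : ℕ) (wt : Fin (n - 1) → ℝ) : Fin n → ℝ :=
  fun i => if h : (i : ℕ) < n - 1 then wt ⟨i, h⟩ else 1 - ∑ j, wt j

/-- The log-barrier function `f_μ`. -/
def fmu {n m k : ℕ} (A : Fin n → Matrix (Fin m) (Fin m) ℝ) (K : Matrix (Fin m) (Fin k) ℝ)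
    (Ψ : Matrix (Fin k) (Fin k) ℝ → ℝ) (μ : ℝ) (wt : Fin (n - 1) → ℝ) : ℝ :=
  Ψ ((Kᵀ * (Mmat A (extendW n wt))⁻¹ * K)⁻¹)
    - μ * ∑ i, Real.log (wt i) - μ * Real.log (1 - ∑ i, wt i)


open Matrix Filter Topology

/-- The information matrix for the subsystem `K`. -/
def Vm {m k : ℕ} (K : Matrix (Fin m) (Fin k) ℝ) (X : Matrix (Fin m) (Fin m) ℝ) :
    Matrix (Fin k) (Fin k) ℝ := (Kᵀ * X⁻¹ * K)⁻¹

lemma K_inj {m k : ℕ} (K : Matrix (Fin m) (Fin k) ℝ) (hK : K.rank = k) :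
    Function.Injective K.mulVec := by
  rw [Matrix.mulVec_injective_iff, linearIndependent_iff_card_eq_finrank_span]
  rw [Set.finrank, ← Matrix.rank_eq_finrank_span_cols, hK]
  simp

lemma inner_posDef {m k : ℕ} {K : Matrix (Fin m) (Fin k) ℝ} (hK : Function.Injective K.mulVec)
    {X : Matrix (Fin m) (Fin m) ℝ} (hX : X.PosDef) : (Kᵀ * X⁻¹ * K).PosDef := by
  have := hX.inv.conjTranspose_mul_mul_same hK
  rwa [conjTranspose_eq_transpose_of_trivial] at this

lemma Vm_posDef {m k : ℕ} {K : Matrix (Fin m) (Fin k) ℝ} (hK : Function.Injective K.mulVec)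
    {X : Matrix (Fin m) (Fin m) ℝ} (hX : X.PosDef) : (Vm K X).PosDef :=
  (inner_posDef hK hX).inv

lemma Vm_le {m k : ℕ} {K : Matrix (Fin m) (Fin k) ℝ} (hK : Function.Injective K.mulVec)
    {X : Matrix (Fin m) (Fin m) ℝ} (hX : X.PosDef) : (X - K * Vm K X * Kᵀ).PosSemidef := by
  have hN := inner_posDef hK hX
  have hV := Vm_posDef hK hX
  have hXu : IsUnit X.det := (Matrix.isUnit_iff_isUnit_det _).1 hX.isUnit
  have hNu : IsUnit (Kᵀ * X⁻¹ * K).det := (Matrix.isUnit_iff_isUnit_det _).1 hN.isUnit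
  have hXt : Xᵀ = X := by simpa [IsHermitian] using hX.isHermitian
  have hVt : (Vm K X)ᵀ = Vm K X := by simpa [IsHermitian] using hV.isHermitian
  have key : (X - K * Vm K X * Kᵀ)ᴴ * X⁻¹ * (X - K * Vm K X * Kᵀ) = X - K * Vm K X * Kᵀ := by
    have h1 : Vm K X * (Kᵀ * X⁻¹ * K) = 1 := Matrix.nonsing_inv_mul _ hNu
    rw [conjTranspose_eq_transpose_of_trivial]
    simp only [transpose_sub, transpose_mul, transpose_transpose, hXt, hVt]
    rw [← Matrix.mul_assoc K, Matrix.sub_mul, Matrix.mul_nonsing_inv _ hXu, Matrix.sub_mul,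
      Matrix.one_mul, Matrix.mul_sub, Matrix.mul_assoc (K * Vm K X * Kᵀ) X⁻¹ X,
      Matrix.nonsing_inv_mul _ hXu, Matrix.mul_one]
    have h2 : K * Vm K X * Kᵀ * X⁻¹ * (K * Vm K X * Kᵀ) = K * Vm K X * Kᵀ := by
      calc _ = K * (Vm K X * (Kᵀ * X⁻¹ * K)) * Vm K X * Kᵀ := by simp only [Matrix.mul_assoc]
        _ = _ := by rw [h1, Matrix.mul_one]
    rw [h2]; simp
  rw [← key]
  exact hX.inv.posSemidef.conjTranspose_mul_mul_same _

lemma le_Vm {m k : ℕ} {K : Matrix (Fin m) (Fin k) ℝ} (hK : Function.Injective K.mulVec)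
    {X : Matrix (Fin m) (Fin m) ℝ} (hX : X.PosDef) {U : Matrix (Fin k) (Fin k) ℝ}
    (hU : (X - K * U * Kᵀ).PosSemidef) : (Vm K X - U).PosSemidef := by
  have hN := inner_posDef hK hX
  have hV := Vm_posDef hK hX
  have hXu : IsUnit X.det := (Matrix.isUnit_iff_isUnit_det _).1 hX.isUnit
  have hNu : IsUnit (Kᵀ * X⁻¹ * K).det := (Matrix.isUnit_iff_isUnit_det _).1 hN.isUnit
  have hXt : Xᵀ = X := by simpa [IsHermitian] using hX.isHermitian
  have hXit : X⁻¹ᵀ = X⁻¹ := by simpa [IsHermitian] using hX.inv.isHermitian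
  have hVt : (Vm K X)ᵀ = Vm K X := by simpa [IsHermitian] using hV.isHermitian
  have h1 : Vm K X * (Kᵀ * X⁻¹ * K) = 1 := Matrix.nonsing_inv_mul _ hNu
  have h1' : (Kᵀ * X⁻¹ * K) * Vm K X = 1 := Matrix.mul_nonsing_inv _ hNu
  have := hU.conjTranspose_mul_mul_same (X⁻¹ * K * Vm K X)
  convert this using 1
  rw [conjTranspose_eq_transpose_of_trivial]
  simp only [transpose_mul, hXit, hVt]
  rw [Matrix.mul_sub, Matrix.sub_mul]
  congr 1
  · calc Vm K X = (Vm K X * (Kᵀ * X⁻¹ * K)) * Vm K X := by rw [h1, Matrix.one_mul]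
      _ = Vm K X * Kᵀ * (X⁻¹ * X) * X⁻¹ * K * Vm K X := by
          rw [Matrix.nonsing_inv_mul _ hXu]; simp only [Matrix.mul_assoc, Matrix.one_mul]
      _ = _ := by simp only [Matrix.mul_assoc]
  · calc U = (Vm K X * (Kᵀ * X⁻¹ * K)) * U * ((Kᵀ * X⁻¹ * K) * Vm K X) := by
          rw [h1, h1', Matrix.one_mul, Matrix.mul_one]
      _ = _ := by simp only [Matrix.mul_assoc]

lemma psd_quad {m : ℕ} {X : Matrix (Fin m) (Fin m) ℝ} (hX : X.PosSemidef) (x : Fin m → ℝ) :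
    0 ≤ x ⬝ᵥ X *ᵥ x := by simpa using hX.dotProduct_mulVec_nonneg x

lemma psd_symm {m : ℕ} {X : Matrix (Fin m) (Fin m) ℝ} (hX : X.IsHermitian) (x y : Fin m → ℝ) :
    x ⬝ᵥ X *ᵥ y = y ⬝ᵥ X *ᵥ x := by
  have hXt : Xᵀ = X := by simpa [IsHermitian] using hX
  rw [dotProduct_mulVec, ← mulVec_transpose, hXt, dotProduct_comm]

lemma psd_cs {m : ℕ} {X : Matrix (Fin m) (Fin m) ℝ} (hX : X.PosSemidef) (x y : Fin m → ℝ) :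
    (y ⬝ᵥ X *ᵥ x) ^ 2 ≤ (y ⬝ᵥ X *ᵥ y) * (x ⬝ᵥ X *ᵥ x) := by
  have h := discrim_le_zero (a := y ⬝ᵥ X *ᵥ y) (b := 2 * (y ⬝ᵥ X *ᵥ x)) (c := x ⬝ᵥ X *ᵥ x) (by
    intro s
    have := psd_quad hX (x + s • y)
    simp only [mulVec_add, mulVec_smul, dotProduct_add, add_dotProduct, smul_dotProduct,
      dotProduct_smul, smul_eq_mul, psd_symm hX.isHermitian x y] at this
    linarith)
  rw [discrim] at h
  nlinarith

lemma KUK_quad {m k : ℕ} (K : Matrix (Fin m) (Fin k) ℝ) (U : Matrix (Fin k) (Fin k) ℝ)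
    (x : Fin m → ℝ) : x ⬝ᵥ (K * U * Kᵀ) *ᵥ x = (Kᵀ *ᵥ x) ⬝ᵥ U *ᵥ (Kᵀ *ᵥ x) := by
  rw [← mulVec_mulVec, ← mulVec_mulVec, dotProduct_mulVec, ← mulVec_transpose]

lemma KUK_herm {m k : ℕ} (K : Matrix (Fin m) (Fin k) ℝ) {U : Matrix (Fin k) (Fin k) ℝ}
    (hU : U.IsHermitian) : (K * U * Kᵀ).IsHermitian := by
  have := isHermitian_mul_mul_conjTranspose K hU
  rwa [conjTranspose_eq_transpose_of_trivial] at this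

lemma exists_U {m k : ℕ} {K : Matrix (Fin m) (Fin k) ℝ} {X : Matrix (Fin m) (Fin m) ℝ}
    (hX : X.PosSemidef) (hR : RangeIncl K X) :
    ∃ U : Matrix (Fin k) (Fin k) ℝ, U.PosDef ∧ (X - K * U * Kᵀ).PosSemidef := by
  have h1 : ∀ a : Fin k, ∃ y : Fin m → ℝ, X *ᵥ y = K *ᵥ Pi.single a 1 := by
    intro a
    have := hR (x := K *ᵥ Pi.single a 1) ⟨Pi.single a 1, by simp⟩
    obtain ⟨y, hy⟩ := this
    exact ⟨y, by simpa using hy⟩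
  choose y hy using h1
  set S : ℝ := ∑ a, (y a ⬝ᵥ X *ᵥ y a) with hS
  have hS0 : 0 ≤ S := Finset.sum_nonneg fun a _ => psd_quad hX _
  have hε : 0 < (1 + S)⁻¹ := by positivity
  have hUd : ((1 + S)⁻¹ • (1 : Matrix (Fin k) (Fin k) ℝ)).PosDef := PosDef.one.smul hε
  refine ⟨(1 + S)⁻¹ • 1, hUd, ?_⟩
  refine PosSemidef.of_dotProduct_mulVec_nonneg
    (hX.isHermitian.sub (KUK_herm K hUd.isHermitian)) fun x => ?_
  simp only [star_trivial]
  rw [sub_mulVec, dotProduct_sub, KUK_quad, smul_mulVec, one_mulVec, dotProduct_smul, smul_eq_mul]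
  have h2 : (Kᵀ *ᵥ x) ⬝ᵥ (Kᵀ *ᵥ x) ≤ S * (x ⬝ᵥ X *ᵥ x) := by
    rw [dotProduct, hS, Finset.sum_mul]
    refine Finset.sum_le_sum fun a _ => ?_
    have h3 : (Kᵀ *ᵥ x) a = y a ⬝ᵥ X *ᵥ x := by
      rw [psd_symm hX.isHermitian, hy]
      rw [mulVec_single_one]
      simp [mulVec, dotProduct, mul_comm]
    rw [h3, ← sq]
    exact psd_cs hX _ _
  have h4 := psd_quad hX x
  have : (1 + S)⁻¹ * ((Kᵀ *ᵥ x) ⬝ᵥ (Kᵀ *ᵥ x)) ≤ x ⬝ᵥ X *ᵥ x := by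
    rw [inv_mul_le_iff₀ (by positivity)]
    nlinarith
  linarith

lemma rangeIncl_of {m k : ℕ} {K : Matrix (Fin m) (Fin k) ℝ} {X : Matrix (Fin m) (Fin m) ℝ}
    {U : Matrix (Fin k) (Fin k) ℝ} (hU : U.PosDef) (h : (X - K * U * Kᵀ).PosSemidef) :
    RangeIncl K X := by
  rintro _ ⟨u, rfl⟩
  by_contra hn
  obtain ⟨f, hf, hker⟩ := Submodule.exists_le_ker_of_notMem hn
  set c : Fin m → ℝ := fun i => f (Pi.single i 1) with hc
  have hfc : ∀ z, f z = c ⬝ᵥ z := by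
    intro z
    rw [LinearMap.pi_apply_eq_sum_univ f z]
    simp only [dotProduct, hc, smul_eq_mul]
    refine Finset.sum_congr rfl fun i _ => ?_
    rw [mul_comm]
    congr 2
    ext j; simp [Pi.single_apply, eq_comm]
  have h0 : c ⬝ᵥ X *ᵥ c = 0 := by
    rw [← hfc]
    exact hker ⟨c, by simp⟩
  have h1 := psd_quad h c
  rw [sub_mulVec, dotProduct_sub, KUK_quad, h0] at h1
  have h2 : Kᵀ *ᵥ c = 0 := by
    by_contra hne
    have := hU.dotProduct_mulVec_pos hne
    simp only [star_trivial] at this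
    linarith
  apply hf
  rw [hfc, toLin'_apply, dotProduct_mulVec, ← mulVec_transpose, h2, zero_dotProduct]

lemma entry_le_trace {k : ℕ} {V : Matrix (Fin k) (Fin k) ℝ} (hV : V.PosSemidef) (a b : Fin k) :
    |V a b| ≤ V.trace := by
  have h := psd_cs hV (Pi.single b 1) (Pi.single a 1)
  simp only [mulVec_single_one, single_one_dotProduct, col_apply] at h
  have hd : ∀ i, V i i ≤ V.trace := fun i =>
    Finset.single_le_sum (f := fun i => V i i) (fun j _ => hV.diag_nonneg) (Finset.mem_univ i)
  have h0 := hV.trace_nonneg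
  refine abs_le_of_sq_le_sq ?_ h0
  calc _ ≤ _ := h
    _ ≤ V.trace * V.trace := mul_le_mul (hd a) (hd b) hV.diag_nonneg h0
    _ = _ := by ring

lemma trace_Vm_le {m k : ℕ} {K : Matrix (Fin m) (Fin k) ℝ} (hK : Function.Injective K.mulVec) :
    ∃ L : Matrix (Fin k) (Fin m) ℝ, ∀ (X : Matrix (Fin m) (Fin m) ℝ)
      (V : Matrix (Fin k) (Fin k) ℝ), (X - K * V * Kᵀ).PosSemidef →
      V.trace ≤ (L * X * Lᵀ).trace := by
  have hKK : (Kᵀ * K).PosDef := by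
    have := PosDef.conjTranspose_mul_self K hK
    rwa [conjTranspose_eq_transpose_of_trivial] at this
  have hu : IsUnit (Kᵀ * K).det := (Matrix.isUnit_iff_isUnit_det _).1 hKK.isUnit
  have hL : (Kᵀ * K)⁻¹ * Kᵀ * K = 1 := by
    rw [Matrix.mul_assoc, Matrix.nonsing_inv_mul _ hu]
  generalize (Kᵀ * K)⁻¹ * Kᵀ = L at hL
  refine ⟨L, fun X V h => ?_⟩
  have h1 := (h.mul_mul_conjTranspose_same L).trace_nonneg
  have hL' : Kᵀ * Lᵀ = 1 := by rw [← transpose_mul, hL, transpose_one]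
  have h2 : L * (K * V * Kᵀ) * Lᵀ = V := by
    calc _ = (L * K) * V * (Kᵀ * Lᵀ) := by simp only [Matrix.mul_assoc]
      _ = V := by rw [hL, hL']; simp
  rw [conjTranspose_eq_transpose_of_trivial, Matrix.mul_sub, Matrix.sub_mul, h2, trace_sub] at h1
  linarith

/-- The first `n - 1` coordinates. -/
def restr (n : ℕ) (v : Fin n → ℝ) : Fin (n - 1) → ℝ :=
  fun i => v ⟨i, lt_of_lt_of_le i.2 (Nat.sub_le n 1)⟩

lemma sum_eq_restr {n : ℕ} (hn : 2 ≤ n) (v : Fin n → ℝ) :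
    ∑ i, v i = ∑ i, restr n v i + v ⟨n - 1, by omega⟩ := by
  obtain ⟨n, rfl⟩ : ∃ p, n = p + 1 := ⟨n - 1, by omega⟩
  exact Fin.sum_univ_castSucc v

lemma extendW_restr {n : ℕ} (hn : 2 ≤ n) {v : Fin n → ℝ} (hv : ∑ i, v i = 1) :
    extendW n (restr n v) = v := by
  have h := sum_eq_restr hn v
  funext i
  unfold extendW
  split_ifs with hi
  · rfl
  · have : i = ⟨n - 1, by omega⟩ := by ext; simp; omega
    rw [this]; linarith

lemma extendW_line {n : ℕ} (a b : Fin (n - 1) → ℝ) (t : ℝ) :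
    extendW n (a + t • (b - a)) = (1 - t) • extendW n a + t • extendW n b := by
  funext i
  simp only [extendW, Pi.add_apply, Pi.smul_apply, smul_eq_mul, Pi.sub_apply]
  split_ifs with hi
  · ring
  · simp only [Finset.sum_add_distrib, ← Finset.mul_sum, Finset.sum_sub_distrib]; ring

lemma extendW_pos {n : ℕ} {wt : Fin (n - 1) → ℝ} (h : wt ∈ Dset n) (i : Fin n) :
    0 < extendW n wt i := by
  unfold extendW
  split_ifs with hi
  · exact h.1 _
  · linarith [h.2]

lemma extendW_sum {n : ℕ} (hn : 2 ≤ n) (wt : Fin (n - 1) → ℝ) : ∑ i, extendW n wt i = 1 := by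
  rw [sum_eq_restr hn]
  have : restr n (extendW n wt) = wt := by
    funext i; simp [restr, extendW]
  rw [this]
  simp [extendW]

lemma extendW_mem {n : ℕ} (hn : 2 ≤ n) {wt : Fin (n - 1) → ℝ} (h : wt ∈ Dset n) :
    extendW n wt ∈ Omega n := ⟨fun i => (extendW_pos h i).le, extendW_sum hn wt⟩

lemma Mmat_line {n m : ℕ} (A : Fin n → Matrix (Fin m) (Fin m) ℝ) (a b : Fin n → ℝ) (s t : ℝ) :
    Mmat A (s • a + t • b) = s • Mmat A a + t • Mmat A b := by
  simp [Mmat, add_smul, mul_smul, Finset.sum_add_distrib, Finset.smul_sum]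

lemma Mmat_psd {n m : ℕ} {A : Fin n → Matrix (Fin m) (Fin m) ℝ} (hA : ∀ i, (A i).PosSemidef)
    {w : Fin n → ℝ} (hw : ∀ i, 0 ≤ w i) : (Mmat A w).PosSemidef :=
  posSemidef_sum _ fun i _ => (hA i).smul (hw i)

lemma Mmat_quad {n m : ℕ} (A : Fin n → Matrix (Fin m) (Fin m) ℝ) (w : Fin n → ℝ)
    (x : Fin m → ℝ) : x ⬝ᵥ Mmat A w *ᵥ x = ∑ i, w i * (x ⬝ᵥ A i *ᵥ x) := by
  simp [Mmat, Matrix.sum_mulVec, dotProduct_sum, smul_mulVec]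

lemma Mmat_posDef {n m : ℕ} {A : Fin n → Matrix (Fin m) (Fin m) ℝ} (hA : ∀ i, (A i).PosSemidef)
    (hex : ∃ w ∈ Omega n, (Mmat A w).PosDef)
    {w : Fin n → ℝ} (hw : ∀ i, 0 < w i) : (Mmat A w).PosDef := by
  obtain ⟨w0, -, h0⟩ := hex
  have hp := Mmat_psd hA fun i => (hw i).le
  refine PosDef.of_dotProduct_mulVec_pos hp.isHermitian fun x hx => ?_
  have h1 := h0.dotProduct_mulVec_pos hx
  simp only [star_trivial] at h1 ⊢
  refine lt_of_le_of_ne (psd_quad hp x) fun h => ?_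
  rw [Mmat_quad, eq_comm, Finset.sum_eq_zero_iff_of_nonneg
    (fun i _ => mul_nonneg (hw i).le (psd_quad (hA i) x))] at h
  rw [Mmat_quad, Finset.sum_eq_zero] at h1
  · exact lt_irrefl _ h1
  · intro i hi
    have := h i hi
    rcases mul_eq_zero.1 this with h2 | h2
    · exact absurd h2 (hw i).ne'
    · rw [h2, mul_zero]

lemma slope_le {G : ℝ → ℝ} {G' c : ℝ} (hG : HasDerivAt G G' 0)
    (h : ∀ t, 0 < t → t < 1 → G t ≤ G 0 + t * c) : G' ≤ c := by
  have h1 := (hasDerivAt_iff_tendsto_slope.1 hG).mono_left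
    (nhdsWithin_mono 0 (fun x (hx : x ∈ Set.Ioi (0:ℝ)) => ne_of_gt hx))
  refine le_of_tendsto h1 ?_
  filter_upwards [Ioo_mem_nhdsGT (show (0:ℝ) < 1 by norm_num)] with t ht
  rw [slope_def_field, sub_zero, div_le_iff₀ ht.1]
  linarith [h t ht.1 ht.2]

lemma key_ineq {n m k : ℕ} (hn : 2 ≤ n)
    {A : Fin n → Matrix (Fin m) (Fin m) ℝ} (hA : ∀ i, (A i).PosSemidef)
    (hex : ∃ w ∈ Omega n, (Mmat A w).PosDef)
    {K : Matrix (Fin m) (Fin k) ℝ} (hK : Function.Injective K.mulVec)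
    {Ψ : Matrix (Fin k) (Fin k) ℝ → ℝ} (hΨ : Assumption1 k Ψ)
    {μ : ℝ} (hμ : 0 < μ) {wt : Fin (n - 1) → ℝ} (hwt : wt ∈ Dset n) {g : Fin (n - 1) → ℝ}
    (hg : HasFDerivAt (fmu A K Ψ μ)
      (∑ i, g i • ContinuousLinearMap.proj (R := ℝ) (φ := fun _ : Fin (n - 1) => ℝ) i) wt)
    {v : Fin n → ℝ} (hv : v ∈ Omega n) {U : Matrix (Fin k) (Fin k) ℝ} (hU : U.PosDef)
    (hUv : (Mmat A v - K * U * Kᵀ).PosSemidef) :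
    Ψ (Vm K (Mmat A (extendW n wt))) ≤ Ψ U + ‖g‖ * n + μ * n := by
  set d : Fin (n - 1) → ℝ := restr n v - wt with hd
  set w := extendW n wt with hw
  have hwpos : ∀ i, 0 < w i := extendW_pos hwt
  have hX := Mmat_posDef hA hex hwpos
  have hV := Vm_posDef hK hX
  set G : ℝ → ℝ := fun t => Ψ (Vm K (Mmat A (extendW n (wt + t • d)))) with hG
  have hG0 : G 0 = Ψ (Vm K (Mmat A w)) := by simp [hG, hw]
  have hsv0 : ∀ i, 0 ≤ restr n v i := fun i => hv.1 _
  have hsv1 : ∑ i, restr n v i ≤ 1 := by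
    have := sum_eq_restr hn v
    rw [hv.2] at this
    linarith [hv.1 ⟨n - 1, by omega⟩]
  -- convexity along the segment
  have hconv : ∀ t, 0 < t → t < 1 → G t ≤ G 0 + t * (Ψ U - G 0) := by
    intro t ht0 ht1
    have e : extendW n (wt + t • d) = (1 - t) • w + t • v := by
      rw [hd, extendW_line, extendW_restr hn hv.2]
    have hXt : (Mmat A (extendW n (wt + t • d))).PosDef := by
      refine Mmat_posDef hA hex fun i => ?_
      rw [e]
      simp only [Pi.add_apply, Pi.smul_apply, smul_eq_mul]
      have := mul_pos (sub_pos.2 ht1) (hwpos i)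
      have := mul_nonneg ht0.le (hv.1 i)
      linarith
    have hW : (t • U + (1 - t) • Vm K (Mmat A w)).PosDef :=
      (hU.smul ht0).add (hV.smul (sub_pos.2 ht1))
    have hle : (Mmat A (extendW n (wt + t • d)) -
        K * (t • U + (1 - t) • Vm K (Mmat A w)) * Kᵀ).PosSemidef := by
      have h1 := (hUv.smul ht0.le).add ((Vm_le hK hX).smul (sub_pos.2 ht1).le)
      convert h1 using 1
      rw [e, Mmat_line]
      simp only [Matrix.mul_add, Matrix.add_mul, Matrix.mul_smul, Matrix.smul_mul, smul_sub]
      abel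
    have h2 := hΨ.decreasing _ _ (Vm_posDef hK hXt).isHermitian hW (le_Vm hK hXt hle)
    have h3 := hΨ.convex U _ hU hV t ht0.le ht1.le
    rw [hG0]
    simp only [hG]
    linarith
  -- derivative along the segment
  have hline : HasDerivAt (fun t : ℝ => wt + t • d) d 0 := by
    have := ((hasDerivAt_id (0:ℝ)).smul_const d).const_add wt
    simpa using this
  have hf : HasDerivAt (fun t : ℝ => fmu A K Ψ μ (wt + t • d)) (∑ i, g i * d i) 0 := by
    have h1 : HasFDerivAt (fmu A K Ψ μ)
      (∑ i, g i • ContinuousLinearMap.proj (R := ℝ) (φ := fun _ : Fin (n - 1) => ℝ) i)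
      (wt + (0:ℝ) • d) := by simpa using hg
    have := h1.comp_hasDerivAt (0:ℝ) hline
    simpa [_root_.sum_apply, Function.comp_def] using this
  have hcoord : ∀ i, HasDerivAt (fun t : ℝ => (wt + t • d) i) (d i) 0 := fun i =>
    (hasDerivAt_pi.1 hline) i
  have hlog : ∀ i, HasDerivAt (fun t : ℝ => Real.log ((wt + t • d) i)) (d i / wt i) 0 := by
    intro i
    have := (hcoord i).log (by simpa using (hwt.1 i).ne')
    simpa using this
  have hlogs : HasDerivAt (fun t : ℝ => ∑ i, Real.log ((wt + t • d) i)) (∑ i, d i / wt i) 0 :=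
    HasDerivAt.fun_sum fun i _ => hlog i
  have hlast : HasDerivAt (fun t : ℝ => Real.log (1 - ∑ i, (wt + t • d) i))
      ((-∑ i, d i) / (1 - ∑ i, wt i)) 0 := by
    have h1 : HasDerivAt (fun t : ℝ => 1 - ∑ i, (wt + t • d) i) (-∑ i, d i) 0 :=
      (HasDerivAt.fun_sum fun i _ => hcoord i).const_sub 1
    have := h1.log (by simpa using (sub_pos.2 hwt.2).ne')
    simpa using this
  have hGd : HasDerivAt G (∑ i, g i * d i + μ * ∑ i, d i / wt i
      + μ * ((-∑ i, d i) / (1 - ∑ i, wt i))) 0 := by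
    have := (hf.add (hlogs.const_mul μ)).add (hlast.const_mul μ)
    refine this.congr_of_eventuallyEq (Eventually.of_forall fun t => ?_)
    simp only [hG, fmu, Vm, Pi.add_apply]
    ring
  have hfin := slope_le hGd hconv
  have b1 : -((n:ℝ) - 1) ≤ ∑ i, d i / wt i := by
    have : ∑ i : Fin (n - 1), (-1:ℝ) ≤ ∑ i, d i / wt i := by
      refine Finset.sum_le_sum fun i _ => ?_
      rw [le_div_iff₀ (hwt.1 i)]
      simp only [hd, Pi.sub_apply]
      linarith [hsv0 i]
    simp only [Finset.sum_const, Finset.card_univ, Fintype.card_fin, nsmul_eq_mul] at this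
    rw [Nat.cast_sub (by omega)] at this
    push_cast at this
    linarith
  have b2 : -1 ≤ (-∑ i, d i) / (1 - ∑ i, wt i) := by
    rw [le_div_iff₀ (sub_pos.2 hwt.2)]
    simp only [hd, Pi.sub_apply, Finset.sum_sub_distrib]
    linarith
  have b3 : -(‖g‖ * n) ≤ ∑ i, g i * d i := by
    have : ∑ i : Fin (n - 1), (-‖g‖) ≤ ∑ i, g i * d i := by
      refine Finset.sum_le_sum fun i _ => ?_
      have hgi : |g i| ≤ ‖g‖ := norm_le_pi_norm g i
      have hdi : |d i| ≤ 1 := by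
        have w1 : wt i ≤ ∑ i, wt i :=
          Finset.single_le_sum (fun j _ => (hwt.1 j).le) (Finset.mem_univ i)
        have v1 : restr n v i ≤ ∑ i, restr n v i :=
          Finset.single_le_sum (fun j _ => hsv0 j) (Finset.mem_univ i)
        have := hwt.1 i
        have := hwt.2
        have := hsv0 i
        simp only [hd, Pi.sub_apply]
        rw [abs_le]; constructor <;> linarith
      have : |g i * d i| ≤ ‖g‖ := by
        rw [abs_mul]
        calc _ ≤ ‖g‖ * 1 := mul_le_mul hgi hdi (abs_nonneg _) (norm_nonneg _)
          _ = _ := mul_one _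
      exact (abs_le.1 this).1
    simp only [Finset.sum_const, Finset.card_univ, Fintype.card_fin, nsmul_eq_mul] at this
    rw [Nat.cast_sub (by omega)] at this
    push_cast at this
    nlinarith [norm_nonneg g]
  rw [hG0] at hfin
  nlinarith [mul_le_mul_of_nonneg_left b1 hμ.le, mul_le_mul_of_nonneg_left b2 hμ.le]

lemma PhiHat_bdd {m k : ℕ} (K : Matrix (Fin m) (Fin k) ℝ)
    {Ψ : Matrix (Fin k) (Fin k) ℝ → ℝ} (hΨ : Assumption1 k Ψ) (X : Matrix (Fin m) (Fin m) ℝ) :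
    BddBelow {y | ∃ U : Matrix (Fin k) (Fin k) ℝ, U.PosDef ∧ (X - K * U * Kᵀ).PosSemidef ∧
      y = Ψ U} := by
  obtain ⟨c, hc⟩ := hΨ.bddBelow
  exact ⟨c, by rintro _ ⟨U, hU, -, rfl⟩; exact hc U hU⟩

lemma PhiHat_le {m k : ℕ} {K : Matrix (Fin m) (Fin k) ℝ}
    {Ψ : Matrix (Fin k) (Fin k) ℝ → ℝ} (hΨ : Assumption1 k Ψ) {X : Matrix (Fin m) (Fin m) ℝ}
    {U : Matrix (Fin k) (Fin k) ℝ} (hU : U.PosDef) (h : (X - K * U * Kᵀ).PosSemidef) :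
    PhiHat K Ψ X ≤ Ψ U :=
  csInf_le (PhiHat_bdd K hΨ X) ⟨U, hU, h, rfl⟩

lemma fstar_le {n m k : ℕ} {A : Fin n → Matrix (Fin m) (Fin m) ℝ} (hA : ∀ i, (A i).PosSemidef)
    {K : Matrix (Fin m) (Fin k) ℝ}
    {Ψ : Matrix (Fin k) (Fin k) ℝ → ℝ} (hΨ : Assumption1 k Ψ) {w : Fin n → ℝ}
    (hw : w ∈ Omega n) (hR : RangeIncl K (Mmat A w)) :
    fstar A K Ψ ≤ PhiHat K Ψ (Mmat A w) := by
  refine csInf_le ?_ ⟨w, hw, hR, rfl⟩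
  obtain ⟨c, hc⟩ := hΨ.bddBelow
  refine ⟨c, ?_⟩
  rintro _ ⟨w, hw, hR, rfl⟩
  obtain ⟨U, hU, h⟩ := exists_U (Mmat_psd hA hw.1) hR
  exact le_csInf ⟨_, U, hU, h, rfl⟩ (by rintro _ ⟨U, hU, -, rfl⟩; exact hc U hU)

lemma exists_near {n m k : ℕ} {A : Fin n → Matrix (Fin m) (Fin m) ℝ}
    (hA : ∀ i, (A i).PosSemidef)
    {K : Matrix (Fin m) (Fin k) ℝ} {Ψ : Matrix (Fin k) (Fin k) ℝ → ℝ}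
    (hne : ∃ w ∈ Omega n, RangeIncl K (Mmat A w)) {b : ℝ} (hb : fstar A K Ψ < b) :
    ∃ v ∈ Omega n, ∃ U : Matrix (Fin k) (Fin k) ℝ, U.PosDef ∧
      (Mmat A v - K * U * Kᵀ).PosSemidef ∧ Ψ U < b := by
  obtain ⟨w0, hw0, hR0⟩ := hne
  obtain ⟨_, ⟨w, hw, hR, rfl⟩, h1⟩ := exists_lt_of_csInf_lt (by exact ⟨_, w0, hw0, hR0, rfl⟩) hb
  obtain ⟨U, hU, h⟩ := exists_U (Mmat_psd hA hw.1) hR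
  obtain ⟨_, ⟨U', hU', h', rfl⟩, h2⟩ := exists_lt_of_csInf_lt (by exact ⟨_, U, hU, h, rfl⟩) h1
  exact ⟨w, hw, U', hU', h', h2⟩

lemma psd_lim {k : ℕ} {X : ℕ → Matrix (Fin k) (Fin k) ℝ} {Y : Matrix (Fin k) (Fin k) ℝ}
    (hX : ∀ j, (X j).PosSemidef) (h : Tendsto X atTop (𝓝 Y)) : Y.PosSemidef := by
  refine PosSemidef.of_dotProduct_mulVec_nonneg ?_ fun x => ?_
  · have h1 : Tendsto (fun j => (X j)ᴴ) atTop (𝓝 Yᴴ) :=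
      ((continuous_id.matrix_conjTranspose).tendsto Y).comp h
    have h2 : (fun j => (X j)ᴴ) = X := funext fun j => (hX j).isHermitian
    rw [h2] at h1
    exact tendsto_nhds_unique h1 h
  · have hc : Continuous fun Z : Matrix (Fin k) (Fin k) ℝ => star x ⬝ᵥ (Z *ᵥ x) := by fun_prop
    exact ge_of_tendsto' ((hc.tendsto Y).comp h) fun j => (hX j).dotProduct_mulVec_nonneg x

lemma posDef_lim {k : ℕ} (hk : 1 ≤ k) {Ψ : Matrix (Fin k) (Fin k) ℝ → ℝ} (hΨ : Assumption1 k Ψ)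
    {X : ℕ → Matrix (Fin k) (Fin k) ℝ} {Y : Matrix (Fin k) (Fin k) ℝ}
    (hX : ∀ j, (X j).PosDef) (h : Tendsto X atTop (𝓝 Y))
    (hb : ∃ C : ℝ, ∀ j i l, |X j i l| ≤ C) {b : ℝ}
    (hl : Tendsto (fun j => Ψ (X j)) atTop (𝓝 b)) : Y.PosDef := by
  have : Nonempty (Fin k) := ⟨⟨0, hk⟩⟩
  have hY := psd_lim (fun j => (hX j).posSemidef) h
  rw [hY.isHermitian.posDef_iff_eigenvalues_pos]
  by_contra hcon
  push Not at hcon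
  obtain ⟨i, hi⟩ := hcon
  have hi0 : hY.isHermitian.eigenvalues i = 0 := le_antisymm hi (hY.eigenvalues_nonneg i)
  have hdet : Y.det = 0 := by
    rw [hY.isHermitian.det_eq_prod_eigenvalues]
    exact Finset.prod_eq_zero (Finset.mem_univ i) (by simp [hi0])
  have hdl : Tendsto (fun j => (X j).det) atTop (𝓝 0) := by
    rw [← hdet]
    exact ((continuous_id.matrix_det).tendsto Y).comp h
  set lam : ℕ → ℝ := fun j => ⨅ i, (hX j).isHermitian.eigenvalues i with hlam
  have hl0 : ∀ j, 0 ≤ lam j := fun j => le_ciInf fun i => ((hX j).eigenvalues_pos i).le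
  have hpow : ∀ j, lam j ^ k ≤ (X j).det := by
    intro j
    rw [(hX j).isHermitian.det_eq_prod_eigenvalues]
    calc lam j ^ k = ∏ i : Fin k, lam j := by simp
      _ ≤ _ := Finset.prod_le_prod (fun _ _ => hl0 j) fun i _ =>
        ciInf_le (Set.finite_range _).bddBelow i
  have hp0 : Tendsto (fun j => lam j ^ k) atTop (𝓝 0) :=
    squeeze_zero (fun j => pow_nonneg (hl0 j) k) hpow hdl
  have hlam0 : Tendsto lam atTop (𝓝 0) := by
    rw [tendsto_order]
    refine ⟨fun a ha => Eventually.of_forall fun j => lt_of_lt_of_le ha (hl0 j), fun a ha => ?_⟩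
    filter_upwards [(tendsto_order.1 hp0).2 (a ^ k) (pow_pos ha k)] with j hj
    exact lt_of_pow_lt_pow_left₀ k ha.le hj
  exact not_tendsto_nhds_of_tendsto_atTop (hΨ.blowup X hX hb hlam0) b hl

/-- If `μ_j → 0` and points `w̃ʲ ∈ D` satisfy `‖∇f_{μ_j}(w̃ʲ)‖ → 0`, then the objective
values converge to `f*` and every accumulation point of `(w(w̃ʲ))` is optimal. -/
theorem approximate_barrier_minimizers_converge (n m k : ℕ) (hn : 2 ≤ n) (hm : 1 ≤ m) (hk : 1 ≤ k) (hkm : k ≤ m)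
    (A : Fin n → Matrix (Fin m) (Fin m) ℝ) (hA : ∀ i, (A i).PosSemidef)
    (hex : ∃ w ∈ Omega n, (Mmat A w).PosDef)
    (K : Matrix (Fin m) (Fin k) ℝ) (hK : K.rank = k)
    (Ψ : Matrix (Fin k) (Fin k) ℝ → ℝ)
    (hΨ : Assumption1 k Ψ)
    (μs : ℕ → ℝ) (hμpos : ∀ j, 0 < μs j) (hμ0 : Tendsto μs atTop (𝓝 0))
    (wts : ℕ → Fin (n - 1) → ℝ) (hwts : ∀ j, wts j ∈ Dset n)
    (gf : ℕ → Fin (n - 1) → ℝ)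
    (hgf : ∀ j, HasFDerivAt (fmu A K Ψ (μs j))
      (∑ i, gf j i • ContinuousLinearMap.proj (R := ℝ) (φ := fun _ : Fin (n - 1) => ℝ) i)
      (wts j))
    (hgf0 : Tendsto (fun j => ‖gf j‖) atTop (𝓝 0)) :
    Tendsto (fun j => Ψ ((Kᵀ * (Mmat A (extendW n (wts j)))⁻¹ * K)⁻¹)) atTop
        (𝓝 (fstar A K Ψ)) ∧
      ∀ x : Fin n → ℝ, MapClusterPt x atTop (fun j => extendW n (wts j)) →
        IsOptimal A K Ψ x := by
  have hKi := K_inj K hK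
  have hmem : ∀ j, extendW n (wts j) ∈ Omega n := fun j => extendW_mem hn (hwts j)
  have hXd : ∀ j, (Mmat A (extendW n (wts j))).PosDef := fun j =>
    Mmat_posDef hA hex (extendW_pos (hwts j))
  have hVd : ∀ j, (Vm K (Mmat A (extendW n (wts j)))).PosDef := fun j => Vm_posDef hKi (hXd j)
  have hVl : ∀ j, (Mmat A (extendW n (wts j)) -
      K * Vm K (Mmat A (extendW n (wts j))) * Kᵀ).PosSemidef := fun j => Vm_le hKi (hXd j)
  have hR : ∀ j, RangeIncl K (Mmat A (extendW n (wts j))) := fun j =>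
    rangeIncl_of (hVd j) (hVl j)
  have hlow : ∀ j, fstar A K Ψ ≤ Ψ (Vm K (Mmat A (extendW n (wts j)))) := fun j =>
    (fstar_le hA hΨ (hmem j) (hR j)).trans (PhiHat_le hΨ (hVd j) (hVl j))
  have hmain : Tendsto (fun j => Ψ (Vm K (Mmat A (extendW n (wts j))))) atTop
      (𝓝 (fstar A K Ψ)) := by
    rw [tendsto_order]
    refine ⟨fun a ha => Eventually.of_forall fun j => lt_of_lt_of_le ha (hlow j), fun b hb => ?_⟩
    obtain ⟨v, hv, U, hU, hUv, hlt⟩ := exists_near hA ⟨_, hmem 0, hR 0⟩ hb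
    have hlim : Tendsto (fun j => Ψ U + ‖gf j‖ * n + μs j * n) atTop (𝓝 (Ψ U)) := by
      have := ((hgf0.mul_const (n:ℝ)).const_add (Ψ U)).add (hμ0.mul_const (n:ℝ))
      simpa using this
    filter_upwards [(tendsto_order.1 hlim).2 b hlt] with j hj
    exact lt_of_le_of_lt (key_ineq hn hA hex hKi hΨ (hμpos j) (hwts j) (hgf j) hv hU hUv) hj
  refine ⟨hmain, fun x hx => ?_⟩
  obtain ⟨φ, hφ, hφx⟩ := hx.tendsto_subseq
  have hMc : Continuous fun w : Fin n → ℝ => Mmat A w := by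
    unfold Mmat; fun_prop
  have hMx : Tendsto (fun j => Mmat A (extendW n (wts (φ j)))) atTop (𝓝 (Mmat A x)) :=
    (hMc.tendsto x).comp hφx
  have hxO : x ∈ Omega n := by
    refine ⟨fun i => ?_, ?_⟩
    · exact ge_of_tendsto' ((tendsto_pi_nhds.1 hφx) i) fun j => (hmem (φ j)).1 i
    · have hc : Continuous fun w : Fin n → ℝ => ∑ i, w i := by fun_prop
      have h1 := (hc.tendsto x).comp hφx
      refine tendsto_nhds_unique h1 ?_
      refine tendsto_const_nhds.congr fun j => ?_
      exact ((hmem (φ j)).2).symm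
  obtain ⟨L, hL⟩ := trace_Vm_le hKi
  have hbd : ∃ C : ℝ, ∀ j i l, |Vm K (Mmat A (extendW n (wts (φ j)))) i l| ≤ C := by
    have hc : Continuous fun X : Matrix (Fin m) (Fin m) ℝ => (L * X * Lᵀ).trace := by fun_prop
    obtain ⟨C, hC⟩ := ((hc.tendsto _).comp hMx).bddAbove_range
    refine ⟨C, fun j i l => (entry_le_trace (hVd (φ j)).posSemidef i l).trans ?_⟩
    exact (hL _ _ (hVl (φ j))).trans (hC ⟨j, rfl⟩)
  obtain ⟨C, hC⟩ := hbd
  have hcomp : IsCompact {V : Fin k → Fin k → ℝ | ∀ i, V i ∈ {r : Fin k → ℝ | ∀ l, r l ∈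
      Set.Icc (-C) C}} :=
    isCompact_pi_infinite fun i => isCompact_pi_infinite fun l => isCompact_Icc
  obtain ⟨Y, -, ψ, hψ, hY⟩ := hcomp.tendsto_subseq
    (X := Fin k → Fin k → ℝ)
    (x := fun j i l => Vm K (Mmat A (extendW n (wts (φ j)))) i l)
    (fun j i l => abs_le.1 (hC j i l))
  obtain ⟨Z, hY'⟩ : ∃ Z : Matrix (Fin k) (Fin k) ℝ,
      Tendsto (fun j => Vm K (Mmat A (extendW n (wts (φ (ψ j)))))) atTop (𝓝 Z) := ⟨Y, hY⟩
  clear hY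
  have hval : Tendsto (fun j => Ψ (Vm K (Mmat A (extendW n (wts (φ (ψ j))))))) atTop
      (𝓝 (fstar A K Ψ)) := hmain.comp (hφ.tendsto_atTop.comp hψ.tendsto_atTop)
  have hYd : Matrix.PosDef Z :=
    posDef_lim hk hΨ (fun j => hVd (φ (ψ j))) hY' ⟨C, fun j => hC (ψ j)⟩ hval
  have hYl : (Mmat A x - K * Z * Kᵀ).PosSemidef := by
    refine psd_lim (fun j => hVl (φ (ψ j))) ?_
    have hc : Continuous fun V : Matrix (Fin k) (Fin k) ℝ => K * V * Kᵀ := by fun_prop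
    exact (hMx.comp hψ.tendsto_atTop).sub ((hc.tendsto _).comp hY')
  have hRx := rangeIncl_of hYd hYl
  refine ⟨hxO, hRx, le_antisymm ?_ (fstar_le hA hΨ hxO hRx)⟩
  refine (PhiHat_le hΨ hYd hYl).trans (le_of_eq ?_)
  have hcont := hΨ.smooth.continuousOn.continuousWithinAt
    (x := Z) hYd
  have h1 := hcont.tendsto.comp (tendsto_nhdsWithin_iff.2
    ⟨hY', Eventually.of_forall fun j => hVd (φ (ψ j))⟩)
  exact tendsto_nhds_unique h1 hval
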